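/- Assume (A3). If M is a circle with p ∉ M such that M ∖ p̄ is a straight line of SA(p,K), then M ∈ ⟨p,K⟩. (Hence together with the converse, the straight lines of SA(p,K) arising from circles are exactly the sets L ∖ {p} with L ∈ ⟨p,K⟩.) -/

import Mathlib

/-- A Laguerre plane: points, circles, and a parallelity relation. -/
structure LaguerrePlane (P : Type*) where
  Circles : Set (Set P)
  Par : P → P → Prop
  par_equiv : Equivalence Par
  joinCircle : ∀ a b c : P, ¬ Par a b → ¬ Par b c → ¬ Par a c →
    ∃! C, C ∈ Circles ∧ a ∈ C ∧ b ∈ C ∧ c ∈ C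
  touching : ∀ K ∈ Circles, ∀ p ∈ K, ∀ q, q ∉ K → ¬ Par p q →
    ∃! C, C ∈ Circles ∧ q ∈ C ∧ K ∩ C = {p}
  parPoint : ∀ (x : P), ∀ K ∈ Circles, ∃! q, Par x q ∧ q ∈ K
  nontriv : ∃ C ∈ Circles,
    (∃ a b c : P, a ∈ C ∧ b ∈ C ∧ c ∈ C ∧ a ≠ b ∧ b ≠ c ∧ a ≠ c) ∧ C ≠ Set.univ

namespace LaguerrePlane

variable {P : Type*}

/-- The generator (parallel class) of a point. -/
def gen (L : LaguerrePlane P) (p : P) : Set P := {q | L.Par p q}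

/-- The pencil ⟨p,K⟩: the circle K together with all circles tangent to K at p. -/
def pencil (L : LaguerrePlane P) (p : P) (K : Set P) : Set (Set P) :=
  insert K {M | M ∈ L.Circles ∧ M ∩ K = {p}}

/-- An automorphism of a Laguerre plane: a bijection of the points mapping
circles onto circles and preserving parallelity. -/
def IsAut (L : LaguerrePlane P) (σ : Equiv.Perm P) : Prop :=
  (∀ C, C ∈ L.Circles ↔ ⇑σ '' C ∈ L.Circles) ∧
  (∀ x y, L.Par x y ↔ L.Par (σ x) (σ y))

/-- The line x ⊔ y of the residual plane SA(p,K):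
{x} together with the orbit of y under the stabilizer of x in Δ. -/
def line (Δ : Subgroup (Equiv.Perm P)) (x y : P) : Set P :=
  {x} ∪ {z | ∃ σ ∈ Δ, σ x = x ∧ σ y = z}

/-- Parallelity of lines of the residual plane SA(p,K). -/
def LinePar (Δ : Subgroup (Equiv.Perm P)) (A B : Set P) : Prop :=
  ∃ σ ∈ Δ, ⇑σ '' A = B

end LaguerrePlane

open LaguerrePlane

namespace LaguerrePlane

variable {P : Type*} (L : LaguerrePlane P)

theorem eq_of_par {C : Set P} (hC : C ∈ L.Circles) {x y : P} (hx : x ∈ C) (hy : y ∈ C)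
    (h : L.Par x y) : x = y :=
  (L.parPoint x C hC).unique ⟨L.par_equiv.refl x, hx⟩ ⟨h, hy⟩

theorem mem_circles_of_mem_pencil {p : P} {K N : Set P} (hK : K ∈ L.Circles)
    (hN : N ∈ L.pencil p K) : N ∈ L.Circles := by
  rcases hN with rfl | hN
  · exact hK
  · exact hN.1

theorem mem_of_mem_pencil {p : P} {K N : Set P} (hp : p ∈ K) (hN : N ∈ L.pencil p K) :
    p ∈ N := by
  rcases hN with rfl | hN
  · exact hp
  · exact (hN.2.symm ▸ Set.mem_singleton p : p ∈ N ∩ K).1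

/-- Two circles of a pencil with carrier `p` that share a point not parallel to `p` coincide. -/
theorem pencil_eq_of_mem {p x : P} {K N N' : Set P} (hK : K ∈ L.Circles) (hp : p ∈ K)
    (hN : N ∈ L.pencil p K) (hN' : N' ∈ L.pencil p K) (hx : x ∈ N) (hx' : x ∈ N')
    (hpx : ¬ L.Par p x) : N = N' := by
  have hne : x ≠ p := fun h => hpx (h ▸ L.par_equiv.refl _)
  have key : ∀ M, M ∈ L.Circles ∧ M ∩ K = {p} → x ∈ M → x ∉ K := fun M hM hxM hxK =>
    hne (hM.2 ▸ ⟨hxM, hxK⟩ : x ∈ ({p} : Set P))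
  rcases hN with rfl | hN <;> rcases hN' with rfl | hN'
  · rfl
  · exact absurd hx (key _ hN' hx')
  · exact absurd hx' (key _ hN hx)
  · exact (L.touching K hK p hp x (key _ hN hx) hpx).unique
      ⟨hN.1, hx, Set.inter_comm N K ▸ hN.2⟩ ⟨hN'.1, hx', Set.inter_comm N' K ▸ hN'.2⟩

/-- If every circle missing `p` touches a circle of the pencil, then a circle missing `p` that
touches a circle of the pencil at `z` has at least three points not parallel to `p`. -/
theorem exists_third_mem {p z w : P} {K M N : Set P} (hK : K ∈ L.Circles) (hp : p ∈ K)
    (htouch : ∀ M ∈ L.Circles, p ∉ M → ∃ N ∈ L.pencil p K, ∃ z, M ∩ N = {z})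
    (hM : M ∈ L.Circles) (hpM : p ∉ M) (hN : N ∈ L.pencil p K) (hz : M ∩ N = {z})
    (hw : w ∈ M) (hpw : ¬ L.Par p w) (hwz : w ≠ z) :
    ∃ z' ∈ M, ¬ L.Par p z' ∧ z' ≠ z ∧ z' ≠ w := by
  by_contra! hcon
  have hrefl := fun x => L.par_equiv.refl x
  have hsymm := fun {x y} => L.par_equiv.symm (x := x) (y := y)
  have htrans := fun {x y z} => L.par_equiv.trans (x := x) (y := y) (z := z)
  have hzMN : z ∈ M ∩ N := hz ▸ Set.mem_singleton z
  have hNC := L.mem_circles_of_mem_pencil hK hN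
  have hpN := L.mem_of_mem_pencil hp hN
  have hpz : ¬ L.Par p z := fun h => hpM (L.eq_of_par hNC hpN hzMN.2 h ▸ hzMN.1)
  have hzw : ¬ L.Par z w := fun h => hwz (L.eq_of_par hM hzMN.1 hw h).symm
  obtain ⟨q, hpq, hqM⟩ := (L.parPoint p M hM).exists
  obtain ⟨v, hwv, hvN⟩ := (L.parPoint w N hNC).exists
  have hzv : ¬ L.Par z v := fun h => hzw (htrans h (hsymm hwv))
  have hpv : ¬ L.Par p v := fun h => hpw (htrans h (hsymm hwv))
  obtain ⟨M', hM', hqM', hzM', hvM'⟩ := (L.joinCircle q z v (fun h => hpz (htrans hpq h)) hzv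
    (fun h => hpv (htrans hpq h))).exists
  have hpM' : p ∉ M' := fun h => hpM (L.eq_of_par hM' h hqM' hpq ▸ hqM)
  obtain ⟨N', hN', t, ht⟩ := htouch M' hM' hpM'
  have htMN : t ∈ M' ∩ N' := ht ▸ Set.mem_singleton t
  have hpt : ¬ L.Par p t := fun h => hpM' (L.eq_of_par (L.mem_circles_of_mem_pencil hK hN')
    (L.mem_of_mem_pencil hp hN') htMN.2 h ▸ htMN.1)
  obtain ⟨s, hts, hsM⟩ := (L.parPoint t M hM).exists
  have htN : t ∈ N := by
    by_cases hsz : s = z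
    · subst hsz
      exact L.eq_of_par hM' htMN.1 hzM' hts ▸ hzMN.2
    · have hsw := hcon s hsM (fun h => hpt (htrans h (hsymm hts))) hsz
      subst hsw
      exact L.eq_of_par hM' htMN.1 hvM' (htrans hts hwv) ▸ hvN
  have hNN' := L.pencil_eq_of_mem hK hp hN hN' htN htMN.2 hpt
  have hzt : z = t := (ht ▸ ⟨hzM', hNN' ▸ hzMN.2⟩ : z ∈ ({t} : Set P))
  have hvt : v = t := (ht ▸ ⟨hvM', hNN' ▸ hvN⟩ : v ∈ ({t} : Set P))
  exact hzv (hzt.trans hvt.symm ▸ hrefl _)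

theorem apply_mem_line {Δ : Subgroup (Equiv.Perm P)} {x y u : P} {σ : Equiv.Perm P}
    (hσ : σ ∈ Δ) (hx : σ x = x) (hu : u ∈ line Δ x y) : σ u ∈ line Δ x y := by
  rcases hu with rfl | ⟨τ, hτ, hτx, rfl⟩
  · exact Or.inl hx
  · exact Or.inr ⟨σ * τ, Δ.mul_mem hσ hτ, by simp [hτx, hx], rfl⟩

/-- If a circle induces the line joining `x` and `y`, the stabilizer of `x` leaves it invariant. -/
theorem image_eq_of_line {Δ : Subgroup (Equiv.Perm P)} {p x y : P} {M : Set P}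
    (hfix : ∀ σ ∈ Δ, ∀ q, L.Par p q → σ q = q) (hM : M \ L.gen p = line Δ x y)
    {σ : Equiv.Perm P} (hσ : σ ∈ Δ) (hx : σ x = x) : σ '' M = M := by
  have key : ∀ τ ∈ Δ, τ x = x → ∀ u ∈ M, τ u ∈ M := by
    intro τ hτ hτx u hu
    by_cases hpu : L.Par p u
    · rwa [hfix τ hτ u hpu]
    · have hmem : u ∈ line Δ x y := hM ▸ ⟨hu, hpu⟩
      exact (hM ▸ apply_mem_line hτ hτx hmem : τ u ∈ M \ L.gen p).1
  apply Set.Subset.antisymm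
  · rintro _ ⟨u, hu, rfl⟩
    exact key σ hσ hx u hu
  · exact fun u hu => ⟨σ⁻¹ u, key σ⁻¹ (Δ.inv_mem hσ) (by rw [Equiv.Perm.inv_eq_iff_eq, hx]) u hu,
      by simp⟩

end LaguerrePlane

/-- assume (A3).  If M is a circle with p ∉ M such that M ∖ p̄ is a
straight line of SA(p,K), then M ∈ ⟨p,K⟩. -/
theorem straight_circle_in_pencil
    {P : Type*} (L : LaguerrePlane P) (p : P) (K : Set P)
    (Δ : Subgroup (Equiv.Perm P))
    (hK : K ∈ L.Circles) (hpK : p ∈ K)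
    (haut : ∀ σ ∈ Δ, L.IsAut σ)
    (hfix : ∀ σ ∈ Δ, ∀ q, L.Par p q → σ q = q)
    (hpen : ∀ σ ∈ Δ, ∀ M ∈ L.pencil p K, ⇑σ '' M ∈ L.pencil p K)
    (hA1 : ∀ x y : P, ¬ L.Par p x → ¬ L.Par p y → ∃ σ ∈ Δ, σ x = y)
    (hA2 : ∀ r ∈ K, r ≠ p → ∀ x ∈ K, x ≠ p → x ≠ r → ∀ y ∈ K, y ≠ p → y ≠ r →
      ∃ σ ∈ Δ, σ r = r ∧ σ x = y)    (hA3 : ∀ M ∈ L.Circles, p ∉ M → ∃! N, N ∈ L.pencil p K ∧ ∃ z, M ∩ N = {z})    :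
    ∀ M ∈ L.Circles, p ∉ M →
    (∃ a b : P, a ∈ M \ L.gen p ∧ b ∈ M \ L.gen p ∧ a ≠ b ∧
      M \ L.gen p = line Δ a b) →
    (∀ z ∈ M \ L.gen p, ∀ w ∈ M \ L.gen p, z ≠ w → M \ L.gen p = line Δ z w) →
    M ∈ L.pencil p K := by
  intro M hM hpM hline hstraight
  exfalso
  obtain ⟨N, ⟨hN, z, hz⟩, huniq⟩ := hA3 M hM hpM
  have hzMN : z ∈ M ∩ N := hz ▸ Set.mem_singleton z
  have hpz : ¬ L.Par p z := fun h => hpM (L.eq_of_par (L.mem_circles_of_mem_pencil hK hN)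
    (L.mem_of_mem_pencil hpK hN) hzMN.2 h ▸ hzMN.1)
  obtain ⟨w, hw, hwz⟩ : ∃ w ∈ M \ L.gen p, w ≠ z := by
    obtain ⟨a, b, ha, hb, hab, -⟩ := hline
    by_cases haz : a = z
    · exact ⟨b, hb, fun h => hab (haz.trans h.symm)⟩
    · exact ⟨a, ha, haz⟩
  obtain ⟨z', hz'M, hpz', hz'z, hz'w⟩ := L.exists_third_mem hK hpK
    (fun M hM hpM => (hA3 M hM hpM).exists) hM hpM hN hz hw.1 hw.2 hwz
  have hMl := hstraight w hw z ⟨hzMN.1, hpz⟩ hwz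
  have hz'l : z' ∈ line Δ w z := hMl ▸ ⟨hz'M, hpz'⟩
  rcases hz'l with h | ⟨σ, hσ, hσw, hσz⟩
  · exact hz'w h
  have hσM := L.image_eq_of_line hfix hMl hσ hσw
  have hσN : M ∩ σ '' N = {z'} := by
    rw [← hσM, ← Set.image_inter σ.injective, hz, Set.image_singleton, hσz]
  have hNN := huniq (σ '' N) ⟨hpen σ hσ N hN, z', hσN⟩
  rw [hNN, hz] at hσN
  exact hz'z (Set.singleton_injective hσN).symm
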